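/- arXiv:1711.03018 — 2 statements merged into one kernel-verified Lean document; each statement's English description precedes it below -/
import Mathlib

section
/- For a matrix A ∈ ℝ₊^{n×n}, the following are equivalent: (i) the deterministic max-product system x_{k+1} = A ⊠ x_k, x_0 ∈ ℝ₊^n, is exponentially stable; (ii) there exists a vector p ∈ ℝ₊^n with strictly positive entries such that A^T ⊠ p < p componentwise (strict inequality in every component). -/
open scoped NNReal

/-- Max-product of a matrix over ℝ₊ = [0,∞) with a vector:
`(A ⊠ x)_i = max_j A_{ij} x_j`. -/
noncomputable def mpMulVec {n m : ℕ} (A : Fin n → Fin m → ℝ≥0) (x : Fin m → ℝ≥0) :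
    Fin n → ℝ≥0 :=
  fun i => Finset.univ.sup fun j => A i j * x j

/-- Infinity norm of a nonnegative vector: `‖x‖ = max_i x_i`. -/
noncomputable def vnorm {n : ℕ} (x : Fin n → ℝ≥0) : ℝ≥0 :=
  Finset.univ.sup x

/-- The trajectory of the deterministic max-product system `x_{k+1} = A ⊠ x_k`. -/
noncomputable def mpTraj {n : ℕ} (A : Fin n → Fin n → ℝ≥0) (x0 : Fin n → ℝ≥0) :
    ℕ → Fin n → ℝ≥0
  | 0 => x0
  | k + 1 => mpMulVec A (mpTraj A x0 k)

/-- Exponential stability of `x_{k+1} = A ⊠ x_k`: there are `a > 1` and `L > 0` with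
`‖x_k‖ ≤ L ‖x_0‖ / a^k` for every initial condition and every `k`. -/
def ExpStable {n : ℕ} (A : Fin n → Fin n → ℝ≥0) : Prop :=
  ∃ a L : ℝ≥0, 1 < a ∧ 0 < L ∧
    ∀ (x0 : Fin n → ℝ≥0) (k : ℕ), vnorm (mpTraj A x0 k) ≤ L * vnorm x0 / a ^ k

theorem le_vnorm {n : ℕ} (x : Fin n → ℝ≥0) (i : Fin n) : x i ≤ vnorm x :=
  Finset.le_sup (f := x) (Finset.mem_univ i)

theorem vnorm_le_iff {n : ℕ} {x : Fin n → ℝ≥0} {c : ℝ≥0} : vnorm x ≤ c ↔ ∀ i, x i ≤ c := by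
  simp [vnorm]

theorem mpMulVec_mono {n m : ℕ} (A : Fin n → Fin m → ℝ≥0) : Monotone (mpMulVec A) :=
  fun _ _ h _ => Finset.sup_mono_fun fun j _ => mul_le_mul_right (h j) _

theorem mpMulVec_smul {n m : ℕ} (A : Fin n → Fin m → ℝ≥0) (c : ℝ≥0) (x : Fin m → ℝ≥0) :
    mpMulVec A (c • x) = c • mpMulVec A x := by
  ext1 i
  simp only [mpMulVec, Pi.smul_apply, smul_eq_mul, NNReal.mul_finset_sup, mul_left_comm]

theorem mpMulVec_single {n m : ℕ} (A : Fin n → Fin m → ℝ≥0) (i : Fin n) (j : Fin m) :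
    A i j ≤ mpMulVec A (Pi.single j 1) i := by
  simpa [mpMulVec] using
    Finset.le_sup (f := fun l => A i l * (Pi.single j 1 : Fin m → ℝ≥0) l) (Finset.mem_univ j)

theorem mpTraj_mono {n : ℕ} (A : Fin n → Fin n → ℝ≥0) (k : ℕ) :
    Monotone fun x => mpTraj A x k := by
  induction k with
  | zero => exact monotone_id
  | succ k ih => exact (mpMulVec_mono A).comp ih

theorem mpTraj_smul {n : ℕ} (A : Fin n → Fin n → ℝ≥0) (c : ℝ≥0) (x : Fin n → ℝ≥0) (k : ℕ) :
    mpTraj A (c • x) k = c • mpTraj A x k := by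
  induction k with
  | zero => rfl
  | succ k ih => simp only [mpTraj, ih, mpMulVec_smul]

theorem mpTraj_mpMulVec {n : ℕ} (A : Fin n → Fin n → ℝ≥0) (x : Fin n → ℝ≥0) (k : ℕ) :
    mpTraj A (mpMulVec A x) k = mpTraj A x (k + 1) := by
  induction k with
  | zero => rfl
  | succ k ih => rw [mpTraj, ih, ← mpTraj]

theorem vnorm_single {n : ℕ} (i : Fin n) : vnorm (Pi.single i 1) = 1 := by
  refine le_antisymm (vnorm_le_iff.2 fun j => ?_) ?_
  · by_cases h : j = i <;> simp [h]
  · simpa using le_vnorm (Pi.single i 1) i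

/-- Entry `A j i` transports the response to the unit vector `e_j` into the next step of the
response to `e_i`. -/
theorem mul_vnorm_mpTraj_single_le {n : ℕ} (A : Fin n → Fin n → ℝ≥0) (i j : Fin n) (k : ℕ) :
    A j i * vnorm (mpTraj A (Pi.single j 1) k) ≤ vnorm (mpTraj A (Pi.single i 1) (k + 1)) := by
  have h : A j i • (Pi.single j 1 : Fin n → ℝ≥0) ≤ mpMulVec A (Pi.single i 1) := by
    intro l
    by_cases hl : l = j
    · subst hl
      simpa using mpMulVec_single A l i
    · simp [hl]
  have h' := mpTraj_mono A k h
  simp only [mpTraj_smul, mpTraj_mpMulVec] at h'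
  rw [vnorm, NNReal.mul_finset_sup]
  exact Finset.sup_le fun l _ => (h' l).trans (le_vnorm _ l)

theorem ExpStable.exists_lyapVector {n : ℕ} {A : Fin n → Fin n → ℝ≥0} (h : ExpStable A) :
    ∃ p : Fin n → ℝ≥0, (∀ i, 0 < p i) ∧
      ∀ i, (Finset.univ.sup fun j => A j i * p j) < p i := by
  obtain ⟨a, L, ha, -, hL⟩ := h
  have ha0 : 0 < a := zero_lt_one.trans ha
  let f : Fin n → ℕ → ℝ≥0 := fun i k => a ^ k * vnorm (mpTraj A (Pi.single i 1) k)
  have hf (i) : BddAbove (Set.range (f i)) := by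
    refine ⟨L, ?_⟩
    rintro _ ⟨k, rfl⟩
    have := hL (Pi.single i 1) k
    rwa [vnorm_single, mul_one, le_div_iff₀' (pow_pos ha0 k)] at this
  have hpos (i) : 0 < ⨆ k, f i k := by
    refine lt_of_lt_of_le zero_lt_one (le_trans (le_of_eq ?_) (le_ciSup (hf i) 0))
    simp [f, mpTraj, vnorm_single]
  refine ⟨fun i => ⨆ k, f i k, hpos, fun i => ?_⟩
  refine lt_of_le_of_lt (Finset.sup_le fun j _ => ?_) (div_lt_self (hpos i) ha)
  rw [NNReal.mul_iSup]
  refine ciSup_le fun k => ?_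
  rw [le_div_iff₀' ha0]
  calc a * (A j i * f j k)
      = a ^ (k + 1) * (A j i * vnorm (mpTraj A (Pi.single j 1) k)) := by simp only [f]; ring
    _ ≤ f i (k + 1) := mul_le_mul_right (mul_vnorm_mpTraj_single_le A i j k) _
    _ ≤ ⨆ k, f i k := le_ciSup (hf i) (k + 1)

theorem exists_contraction_factor {n : ℕ} {p r : Fin n → ℝ≥0} (h : ∀ i, r i < p i) :
    ∃ γ : ℝ≥0, 0 < γ ∧ γ < 1 ∧ ∀ i, r i ≤ γ * p i := by
  refine ⟨max 2⁻¹ (vnorm fun i => r i / p i), lt_max_of_lt_left (by norm_num), max_lt ?_ ?_,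
    fun i => ?_⟩
  · exact inv_lt_one_of_one_lt₀ one_lt_two
  · exact (Finset.sup_lt_iff zero_lt_one).2 fun i _ =>
      (div_lt_one (pos_of_gt (h i))).2 (h i)
  · rw [← div_le_iff₀ (pos_of_gt (h i))]
    exact (le_vnorm (fun i => r i / p i) i).trans (le_max_right _ _)

/-- The weighted norm `max_i p_i x_i` contracts by `γ` along trajectories. -/
theorem mul_mpTraj_le {n : ℕ} {A : Fin n → Fin n → ℝ≥0} {p : Fin n → ℝ≥0} {γ C : ℝ≥0}
    (hA : ∀ i j, A j i * p j ≤ γ * p i) {x : Fin n → ℝ≥0} (hx : ∀ i, p i * x i ≤ C) (k : ℕ)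
    (i : Fin n) : p i * mpTraj A x k i ≤ γ ^ k * C := by
  induction k generalizing i with
  | zero => simpa [mpTraj] using hx i
  | succ k ih =>
    rw [mpTraj, mpMulVec, NNReal.mul_finset_sup]
    refine Finset.sup_le fun j _ => ?_
    calc p i * (A i j * mpTraj A x k j) = A i j * p i * mpTraj A x k j := by ring
      _ ≤ γ * p j * mpTraj A x k j := mul_le_mul_left (hA j i) _
      _ = γ * (p j * mpTraj A x k j) := by ring
      _ ≤ γ * (γ ^ k * C) := mul_le_mul_right (ih j) _
      _ = γ ^ (k + 1) * C := by ring

theorem expStable_of_lyapVector {n : ℕ} {A : Fin n → Fin n → ℝ≥0} {p : Fin n → ℝ≥0}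
    (hp : ∀ i, 0 < p i) (h : ∀ i, (Finset.univ.sup fun j => A j i * p j) < p i) :
    ExpStable A := by
  obtain ⟨γ, hγ0, hγ1, hγ⟩ := exists_contraction_factor h
  have hA (i j) : A j i * p j ≤ γ * p i :=
    (Finset.le_sup (f := fun j => A j i * p j) (Finset.mem_univ j)).trans (hγ i)
  refine ⟨γ⁻¹, vnorm p⁻¹ * vnorm p + 1, (one_lt_inv₀ hγ0).2 hγ1, by positivity,
    fun x k => vnorm_le_iff.2 fun i => ?_⟩
  have hx (i) : p i * x i ≤ vnorm p * vnorm x :=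
    mul_le_mul' (le_vnorm p i) (le_vnorm x i)
  calc mpTraj A x k i = (p i)⁻¹ * (p i * mpTraj A x k i) :=
        (inv_mul_cancel_left₀ (hp i).ne' _).symm
    _ ≤ vnorm p⁻¹ * (γ ^ k * (vnorm p * vnorm x)) :=
        mul_le_mul' (le_vnorm p⁻¹ i) (mul_mpTraj_le hA hx k i)
    _ = vnorm p⁻¹ * vnorm p * vnorm x / γ⁻¹ ^ k := by
        rw [inv_pow, div_inv_eq_mul]; ring
    _ ≤ (vnorm p⁻¹ * vnorm p + 1) * vnorm x / γ⁻¹ ^ k := by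
        gcongr
        exact le_self_add

/-- the system `x_{k+1} = A ⊠ x_k` is exponentially stable iff there is a
vector `p` with strictly positive entries such that `A^T ⊠ p < p` componentwise,
i.e. `max_j A_{ji} p_j < p_i` for every `i`. -/
theorem expStable_iff_lyapVector {n : ℕ} (A : Fin n → Fin n → ℝ≥0) :
    ExpStable A ↔
      ∃ p : Fin n → ℝ≥0, (∀ i, 0 < p i) ∧
        ∀ i, (Finset.univ.sup fun j => A j i * p j) < p i :=
  ⟨ExpStable.exists_lyapVector, fun ⟨_, hp, h⟩ => expStable_of_lyapVector hp h⟩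
end

section
/- Consider the max-product system with Markovian jumps x_{k+1} = A(y_k) ⊠ x_k, where y_k is a Markov chain on {1,…,M} with transition probabilities c_{ij} and A(1),…,A(M) ∈ ℝ₊^{n×n}. If there exist vectors p(1),…,p(M) with strictly positive entries and a constant δ < 1 such that Σ_{j=1}^M c_{ij} · (p(j)^T ⊠ A(i) ⊠ p^{-1}(i)) ≤ δ for every i = 1,…,M, where p^{-1}(i) is the vector of componentwise inverses of the entries of p(i), then the system is mean norm exponentially stable and almost surely stable. -/
open scoped NNReal ENNReal
open MeasureTheory Filter

/-- Max-product of a row vector with a vector: `p^T ⊠ x = max_i p_i x_i`. -/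
noncomputable def mpDot {n : ℕ} (q x : Fin n → ℝ≥0) : ℝ≥0 :=
  Finset.univ.sup fun i => q i * x i

/-- `y` is a Markov chain on `{1,…,M}` with transition probabilities `c`. -/
def IsMarkovChain {Ω : Type*} [MeasurableSpace Ω] (P : Measure Ω) {M : ℕ}
    (y : ℕ → Ω → Fin M) (c : Fin M → Fin M → ℝ≥0) : Prop :=
  (∀ k, Measurable (y k)) ∧
  ∀ (k : ℕ) (s : ℕ → Fin M) (j : Fin M),
    P {ω | (∀ t ≤ k, y t ω = s t) ∧ y (k + 1) ω = j}
      = (c (s k) j : ℝ≥0∞) * P {ω | ∀ t ≤ k, y t ω = s t}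

/-- The random trajectory of the Markov-jump max-product system
`x_{k+1} = A(y_k) ⊠ x_k`, `x_0` deterministic. -/
noncomputable def mjTraj {Ω : Type*} {n M : ℕ} (A : Fin M → Fin n → Fin n → ℝ≥0)
    (y : ℕ → Ω → Fin M) (x0 : Fin n → ℝ≥0) : ℕ → Ω → Fin n → ℝ≥0
  | 0 => fun _ => x0
  | k + 1 => fun ω => mpMulVec (A (y k ω)) (mjTraj A y x0 k ω)

/-- Mean norm exponential stability: `E[‖x_k‖] ≤ L ‖x_0‖ / a^k` for some `a > 1`, `L > 0`. -/
def MeanNormExpStable {Ω : Type*} [MeasurableSpace Ω] (P : Measure Ω) {n M : ℕ}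
    (A : Fin M → Fin n → Fin n → ℝ≥0) (y : ℕ → Ω → Fin M) : Prop :=
  ∃ a L : ℝ≥0, 1 < a ∧ 0 < L ∧
    ∀ (x0 : Fin n → ℝ≥0) (k : ℕ),
      ∫⁻ ω, (vnorm (mjTraj A y x0 k ω) : ℝ≥0∞) ∂P ≤ (L * vnorm x0 : ℝ≥0) / (a : ℝ≥0∞) ^ k

theorem mpMulVec_apply_le {n m : ℕ} (A : Fin n → Fin m → ℝ≥0) {x z : Fin m → ℝ≥0} {b : ℝ≥0}
    (h : ∀ s, x s ≤ z s * b) (r : Fin n) : mpMulVec A x r ≤ mpMulVec A z r * b := by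
  refine Finset.sup_le fun s _ => ?_
  calc A r s * x s ≤ A r s * (z s * b) := by gcongr; exact h s
    _ = A r s * z s * b := by ring
    _ ≤ mpMulVec A z r * b := by
        gcongr
        exact Finset.le_sup (f := fun s => A r s * z s) (Finset.mem_univ s)

theorem mpDot_le_mul {n : ℕ} (q : Fin n → ℝ≥0) {x z : Fin n → ℝ≥0} {b : ℝ≥0}
    (h : ∀ s, x s ≤ z s * b) : mpDot q x ≤ mpDot q z * b :=
  Finset.sup_le fun s _ => by
    calc q s * x s ≤ q s * (z s * b) := by gcongr; exact h s
      _ = q s * z s * b := by ring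
      _ ≤ mpDot q z * b := by
          gcongr
          exact Finset.le_sup (f := fun s => q s * z s) (Finset.mem_univ s)

theorem le_inv_mul_mpDot {n : ℕ} {q : Fin n → ℝ≥0} (hq : ∀ r, 0 < q r) (x : Fin n → ℝ≥0)
    (s : Fin n) : x s ≤ (q s)⁻¹ * mpDot q x := by
  rw [inv_mul_eq_div, le_div_iff₀ (hq s), mul_comm]
  exact Finset.le_sup (f := fun s => q s * x s) (Finset.mem_univ s)

/-- One step of the system multiplies the weighted norm by at most `q^T ⊠ A ⊠ p⁻¹`. -/
theorem mpDot_mpMulVec_le {n m : ℕ} (q : Fin n → ℝ≥0) (A : Fin n → Fin m → ℝ≥0)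
    {p : Fin m → ℝ≥0} (hp : ∀ r, 0 < p r) (x : Fin m → ℝ≥0) :
    mpDot q (mpMulVec A x) ≤ mpDot q (mpMulVec A fun s => (p s)⁻¹) * mpDot p x :=
  mpDot_le_mul q (mpMulVec_apply_le A (le_inv_mul_mpDot hp x))

theorem mpDot_le_vnorm_mul_vnorm {n : ℕ} (q x : Fin n → ℝ≥0) :
    mpDot q x ≤ vnorm q * vnorm x :=
  Finset.sup_le fun s _ =>
    mul_le_mul' (Finset.le_sup (Finset.mem_univ s)) (Finset.le_sup (Finset.mem_univ s))

theorem vnorm_le_mul_mpDot {n : ℕ} {q : Fin n → ℝ≥0} (hq : ∀ r, 0 < q r) (x : Fin n → ℝ≥0) :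
    vnorm x ≤ vnorm (fun s => (q s)⁻¹) * mpDot q x :=
  Finset.sup_le fun s _ => (le_inv_mul_mpDot hq x s).trans <| by
    gcongr
    exact Finset.le_sup (f := fun s => (q s)⁻¹) (Finset.mem_univ s)

theorem mjTraj_congr {Ω : Type*} {n M : ℕ} (A : Fin M → Fin n → Fin n → ℝ≥0)
    (y : ℕ → Ω → Fin M) (x0 : Fin n → ℝ≥0) {k : ℕ} {ω ω' : Ω}
    (h : ∀ t < k, y t ω = y t ω') : mjTraj A y x0 k ω = mjTraj A y x0 k ω' := by
  induction k with
  | zero => rfl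
  | succ k ih =>
    simp only [mjTraj, h k k.lt_succ_self, ih fun t ht => h t (ht.trans k.lt_succ_self)]

theorem measurable_finset_sup_nnreal {Ω ι : Type*} [MeasurableSpace Ω] (s : Finset ι)
    {f : ι → Ω → ℝ≥0} (hf : ∀ i, Measurable (f i)) : Measurable fun ω => s.sup fun i => f i ω := by
  classical
  induction s using Finset.induction with
  | empty => simp
  | insert a s _ ih =>
    simp only [Finset.sup_insert]
    exact (hf a).sup ih

theorem measurable_mjTraj {Ω : Type*} [MeasurableSpace Ω] {n M : ℕ}
    (A : Fin M → Fin n → Fin n → ℝ≥0) {y : ℕ → Ω → Fin M} (hy : ∀ k, Measurable (y k))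
    (x0 : Fin n → ℝ≥0) (k : ℕ) : Measurable (mjTraj A y x0 k) := by
  induction k with
  | zero => exact measurable_const
  | succ k ih =>
    refine measurable_pi_lambda _ fun i => measurable_finset_sup_nnreal Finset.univ
      (f := fun j ω => A (y k ω) i j * mjTraj A y x0 k ω j) fun j => ?_
    exact ((Measurable.of_discrete (f := fun m => A m i j)).comp (hy k)).mul
      ((measurable_pi_apply j).comp ih)

/-- Comparing two integrals on the fibers of a discrete random variable suffices. -/
theorem lintegral_le_mul_of_fiber {Ω β : Type*} [MeasurableSpace Ω] [MeasurableSpace β]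
    [Countable β] [MeasurableSingletonClass β] {P : Measure Ω} {Y : Ω → β} (hY : Measurable Y)
    {F G : Ω → ℝ≥0∞} {r : ℝ≥0∞}
    (h : ∀ ω₀, ∫⁻ ω in Y ⁻¹' {Y ω₀}, F ω ∂P ≤ r * ∫⁻ ω in Y ⁻¹' {Y ω₀}, G ω ∂P) :
    ∫⁻ ω, F ω ∂P ≤ r * ∫⁻ ω, G ω ∂P := by
  have split (H : Ω → ℝ≥0∞) : ∫⁻ ω, H ω ∂P = ∑' b, ∫⁻ ω in Y ⁻¹' {b}, H ω ∂P := by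
    rw [← lintegral_iUnion (fun b => hY (measurableSet_singleton b)) (fun a b hab =>
      (Set.disjoint_singleton.2 hab).preimage Y), ← Set.preimage_iUnion, Set.iUnion_of_singleton,
      Set.preimage_univ, setLIntegral_univ]
  rw [split F, split G, ← ENNReal.tsum_mul_left]
  refine ENNReal.tsum_le_tsum fun b => ?_
  by_cases hb : ∃ ω₀, Y ω₀ = b
  · obtain ⟨ω₀, rfl⟩ := hb
    exact h ω₀
  · have : Y ⁻¹' {b} = ∅ := by
      ext ω
      simpa using fun hω => hb ⟨ω, hω⟩
    simp [this]

/-- One-step contraction in mean of the mode-dependent weighted norm. -/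
theorem lintegral_mpDot_mjTraj_succ_le {Ω : Type*} [MeasurableSpace Ω] {P : Measure Ω} {n M : ℕ}
    (A : Fin M → Fin n → Fin n → ℝ≥0) {c : Fin M → Fin M → ℝ≥0} {y : ℕ → Ω → Fin M}
    (hmc : IsMarkovChain P y c) {p : Fin M → Fin n → ℝ≥0} (hp : ∀ i r, 0 < p i r) {δ : ℝ≥0}
    (hlyap : ∀ i : Fin M,
      ∑ j, c i j * mpDot (p j) (mpMulVec (A i) fun s => (p i s)⁻¹) ≤ δ)
    (x0 : Fin n → ℝ≥0) (k : ℕ) :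
    ∫⁻ ω, (mpDot (p (y (k + 1) ω)) (mjTraj A y x0 (k + 1) ω) : ℝ≥0∞) ∂P
      ≤ δ * ∫⁻ ω, (mpDot (p (y k ω)) (mjTraj A y x0 k ω) : ℝ≥0∞) ∂P := by
  have hY : Measurable fun ω (t : Fin (k + 1)) => y t ω := measurable_pi_lambda _ fun t => hmc.1 t
  refine lintegral_le_mul_of_fiber hY fun ω₀ => ?_
  set H := (fun ω (t : Fin (k + 1)) => y t ω) ⁻¹' {fun t : Fin (k + 1) => y t ω₀} with hH
  have mem_H (ω : Ω) : ω ∈ H ↔ ∀ t ≤ k, y t ω = y t ω₀ := by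
    simp only [hH, Set.mem_preimage, Set.mem_singleton_iff, funext_iff, Fin.forall_iff,
      Nat.lt_succ_iff]
  have hHm : MeasurableSet H := hY (measurableSet_singleton _)
  have hPH : P {ω | ∀ t ≤ k, y t ω = y t ω₀} = P H := by
    congr 1
    ext ω
    exact (mem_H ω).symm
  have traj_eq {ω : Ω} (hω : ω ∈ H) : mjTraj A y x0 k ω = mjTraj A y x0 k ω₀ :=
    mjTraj_congr A y x0 fun t ht => (mem_H ω).1 hω t ht.le
  set i := y k ω₀
  set v := mpDot (p i) (mjTraj A y x0 k ω₀)
  set g : Fin M → ℝ≥0 := fun j => mpDot (p j) (mpMulVec (A i) fun s => (p i s)⁻¹)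
  have trans_prob (j : Fin M) : (P.restrict H).map (y (k + 1)) {j} = c i j * P H := by
    rw [Measure.map_apply (hmc.1 _) (measurableSet_singleton j),
      Measure.restrict_apply (hmc.1 _ (measurableSet_singleton j)), ← hPH,
      ← hmc.2 k (fun t => y t ω₀) j]
    congr 1
    ext ω
    simp only [Set.mem_inter_iff, Set.mem_preimage, Set.mem_singleton_iff, mem_H,
      Set.mem_ofPred_eq, and_comm]
  have mean_g : ∫⁻ ω in H, (g (y (k + 1) ω) : ℝ≥0∞) ∂P ≤ δ * P H := by
    rw [← lintegral_map (f := fun j => (g j : ℝ≥0∞)) Measurable.of_discrete (hmc.1 (k + 1)),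
      lintegral_fintype]
    calc ∑ j, (g j : ℝ≥0∞) * (P.restrict H).map (y (k + 1)) {j}
        = ((∑ j, c i j * g j : ℝ≥0) : ℝ≥0∞) * P H := by
          push_cast
          rw [Finset.sum_mul]
          refine Finset.sum_congr rfl fun j _ => ?_
          rw [trans_prob]
          ring
      _ ≤ δ * P H := by
          gcongr
          exact hlyap i
  calc ∫⁻ ω in H, (mpDot (p (y (k + 1) ω)) (mjTraj A y x0 (k + 1) ω) : ℝ≥0∞) ∂P
      ≤ ∫⁻ ω in H, (v : ℝ≥0∞) * g (y (k + 1) ω) ∂P := by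
        refine setLIntegral_mono' hHm fun ω hω => ?_
        rw [mul_comm]
        have hi : y k ω = i := (mem_H ω).1 hω k le_rfl
        simp only [mjTraj, traj_eq hω, hi]
        exact_mod_cast mpDot_mpMulVec_le (p (y (k + 1) ω)) (A i) (hp i) (mjTraj A y x0 k ω₀)
    _ = v * ∫⁻ ω in H, (g (y (k + 1) ω) : ℝ≥0∞) ∂P :=
        lintegral_const_mul' _ _ ENNReal.coe_ne_top
    _ ≤ v * (δ * P H) := by gcongr
    _ = δ * ∫⁻ _ in H, (v : ℝ≥0∞) ∂P := by
        rw [setLIntegral_const]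
        ring
    _ = δ * ∫⁻ ω in H, (mpDot (p (y k ω)) (mjTraj A y x0 k ω) : ℝ≥0∞) ∂P := by
        congr 1
        refine setLIntegral_congr_fun hHm fun ω hω => ?_
        have hi : y k ω = i := (mem_H ω).1 hω k le_rfl
        simp only [traj_eq hω, hi, v]

theorem lintegral_mpDot_mjTraj_le {Ω : Type*} [MeasurableSpace Ω] {P : Measure Ω} {n M : ℕ}
    (A : Fin M → Fin n → Fin n → ℝ≥0) {c : Fin M → Fin M → ℝ≥0} {y : ℕ → Ω → Fin M}
    (hmc : IsMarkovChain P y c) {p : Fin M → Fin n → ℝ≥0} (hp : ∀ i r, 0 < p i r) {δ : ℝ≥0}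
    (hlyap : ∀ i : Fin M,
      ∑ j, c i j * mpDot (p j) (mpMulVec (A i) fun s => (p i s)⁻¹) ≤ δ)
    (x0 : Fin n → ℝ≥0) (k : ℕ) :
    ∫⁻ ω, (mpDot (p (y k ω)) (mjTraj A y x0 k ω) : ℝ≥0∞) ∂P
      ≤ δ ^ k * ∫⁻ ω, (mpDot (p (y 0 ω)) x0 : ℝ≥0∞) ∂P := by
  induction k with
  | zero => simp [mjTraj]
  | succ k ih =>
    rw [pow_succ', mul_assoc]
    exact (lintegral_mpDot_mjTraj_succ_le A hmc hp hlyap x0 k).trans (by gcongr)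

theorem meanNormExpStable_of_lyapunov {Ω : Type*} [MeasurableSpace Ω] {P : Measure Ω}
    [IsProbabilityMeasure P] {n M : ℕ} (A : Fin M → Fin n → Fin n → ℝ≥0)
    {c : Fin M → Fin M → ℝ≥0} {y : ℕ → Ω → Fin M} (hmc : IsMarkovChain P y c)
    {p : Fin M → Fin n → ℝ≥0} (hp : ∀ i r, 0 < p i r) {δ : ℝ≥0} (hδ : δ < 1)
    (hlyap : ∀ i : Fin M,
      ∑ j, c i j * mpDot (p j) (mpMulVec (A i) fun s => (p i s)⁻¹) ≤ δ) :
    MeanNormExpStable P A y := by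
  obtain ⟨ρ, hδρ, hρ⟩ := exists_between hδ
  have hρ0 : 0 < ρ := pos_of_gt hδρ
  set C := Finset.univ.sup fun i => vnorm (p i)
  set D := Finset.univ.sup fun i => vnorm fun s => (p i s)⁻¹
  refine ⟨ρ⁻¹, D * C + 1, (one_lt_inv₀ hρ0).2 hρ, by positivity, fun x0 k => ?_⟩
  calc ∫⁻ ω, (vnorm (mjTraj A y x0 k ω) : ℝ≥0∞) ∂P
      ≤ ∫⁻ ω, D * (mpDot (p (y k ω)) (mjTraj A y x0 k ω) : ℝ≥0∞) ∂P := by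
        refine lintegral_mono fun ω => ?_
        have hD : vnorm (fun s => (p (y k ω) s)⁻¹) ≤ D :=
          Finset.le_sup (f := fun i => vnorm fun s => (p i s)⁻¹) (Finset.mem_univ _)
        rw [← ENNReal.coe_mul, ENNReal.coe_le_coe]
        exact (vnorm_le_mul_mpDot (hp _) _).trans (mul_le_mul_left hD _)
    _ = D * ∫⁻ ω, (mpDot (p (y k ω)) (mjTraj A y x0 k ω) : ℝ≥0∞) ∂P :=
        lintegral_const_mul' _ _ ENNReal.coe_ne_top
    _ ≤ D * (ρ ^ k * ∫⁻ ω, (mpDot (p (y 0 ω)) x0 : ℝ≥0∞) ∂P) := by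
        gcongr
        exact lintegral_mpDot_mjTraj_le A hmc hp (fun i => (hlyap i).trans hδρ.le) x0 k
    _ ≤ D * (ρ ^ k * ∫⁻ _, ((C * vnorm x0 : ℝ≥0) : ℝ≥0∞) ∂P) := by
        gcongr with ω
        have hC : vnorm (p (y 0 ω)) ≤ C :=
          Finset.le_sup (f := fun i => vnorm (p i)) (Finset.mem_univ _)
        exact (mpDot_le_vnorm_mul_vnorm _ _).trans (mul_le_mul_left hC _)
    _ = ((D * C * vnorm x0 * ρ ^ k : ℝ≥0) : ℝ≥0∞) := by
        rw [lintegral_const, measure_univ]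
        push_cast
        ring
    _ ≤ (((D * C + 1) * vnorm x0 * ρ ^ k : ℝ≥0) : ℝ≥0∞) := by
        gcongr
        exact le_self_add
    _ = (((D * C + 1) * vnorm x0 : ℝ≥0) : ℝ≥0∞) / ((ρ⁻¹ : ℝ≥0) : ℝ≥0∞) ^ k := by
        rw [ENNReal.coe_inv hρ0.ne', ← ENNReal.inv_pow, div_eq_mul_inv, inv_inv]
        push_cast
        rfl

/-- Mean norm exponential stability implies almost sure stability. -/
theorem MeanNormExpStable.ae_tendsto_zero {Ω : Type*} [MeasurableSpace Ω] {P : Measure Ω}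
    {n M : ℕ} {A : Fin M → Fin n → Fin n → ℝ≥0} {y : ℕ → Ω → Fin M}
    (h : MeanNormExpStable P A y) (hy : ∀ k, Measurable (y k)) (x0 : Fin n → ℝ≥0) :
    ∀ᵐ ω ∂P, Tendsto (fun k => mjTraj A y x0 k ω) atTop (nhds 0) := by
  obtain ⟨a, L, ha, -, hb⟩ := h
  have hm (k : ℕ) : Measurable fun ω => (vnorm (mjTraj A y x0 k ω) : ℝ≥0∞) :=
    (measurable_finset_sup_nnreal _ fun i =>
      (measurable_pi_apply i).comp (measurable_mjTraj A hy x0 k)).coe_nnreal_ennreal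
  have hfin : ∫⁻ ω, ∑' k, (vnorm (mjTraj A y x0 k ω) : ℝ≥0∞) ∂P ≠ ∞ := by
    rw [lintegral_tsum fun k => (hm k).aemeasurable]
    refine ne_top_of_le_ne_top ?_ (ENNReal.tsum_le_tsum fun k => hb x0 k)
    simp_rw [div_eq_mul_inv, ENNReal.tsum_mul_left, ENNReal.inv_pow, ENNReal.tsum_geometric]
    refine ENNReal.mul_ne_top ENNReal.coe_ne_top (ENNReal.inv_ne_top.2 ?_)
    exact (tsub_pos_of_lt (ENNReal.inv_lt_one.2 (by exact_mod_cast ha))).ne'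
  filter_upwards [ae_lt_top (Measurable.tsum hm) hfin] with ω hω
  have hlim : Tendsto (fun k => vnorm (mjTraj A y x0 k ω)) atTop (nhds 0) :=
    ENNReal.tendsto_coe.1 (ENNReal.tendsto_atTop_zero_of_tsum_ne_top hω.ne)
  refine tendsto_pi_nhds.2 fun i => ?_
  exact tendsto_of_tendsto_of_tendsto_of_le_of_le tendsto_const_nhds hlim (fun _ => zero_le)
    fun k => Finset.le_sup (f := mjTraj A y x0 k ω) (Finset.mem_univ i)

/-- Corollary 1 of the paper: if there are vectors `p(1), …, p(M)` with
strictly positive entries and `δ < 1` such that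
`Σ_j c_{ij} (p(j)^T ⊠ A(i) ⊠ p⁻¹(i)) ≤ δ` for every `i`, where `p⁻¹(i)` is the vector of
componentwise inverses of `p(i)`, then the Markov-jump max-product system
`x_{k+1} = A(y_k) ⊠ x_k` is mean norm exponentially stable and almost surely stable. -/
theorem stable_of_simplified_lyapunov_cond {Ω : Type*} [MeasurableSpace Ω] (P : Measure Ω)
    [IsProbabilityMeasure P] {n M : ℕ} (A : Fin M → Fin n → Fin n → ℝ≥0)
    (c : Fin M → Fin M → ℝ≥0) (y : ℕ → Ω → Fin M)
    (hmc : IsMarkovChain P y c) (hrow : ∀ i, ∑ j, c i j = 1)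
    (p : Fin M → Fin n → ℝ≥0) (hp : ∀ i r, 0 < p i r) (δ : ℝ≥0) (hδ : δ < 1)
    (hlyap : ∀ i : Fin M,
      ∑ j, c i j * mpDot (p j) (mpMulVec (A i) fun s => (p i s)⁻¹) ≤ δ) :
    MeanNormExpStable P A y ∧
      ∀ x0 : Fin n → ℝ≥0,
        ∀ᵐ ω ∂P, Tendsto (fun k => mjTraj A y x0 k ω) atTop (nhds 0) := by
  have h := meanNormExpStable_of_lyapunov A hmc hp hδ hlyap
  exact ⟨h, h.ae_tendsto_zero hmc.1⟩
end
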